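/- (EDCS in edge sampled subgraphs) There exists an absolute constant C > 0 such that the following holds. Fix a graph G = (V,E) on n ≥ 2 vertices, p ∈ (0,1], λ ∈ (0, 1/100), and a real β ≥ 750·λ^{-2}·log n. Let G₁ and G₂ be two random subgraphs of G defined on a common probability space, each distributed (marginally) as an edge sampled subgraph of G with probability p, but not necessarily independent of each other. For i ∈ {1,2}, let H_i be an EDCS(G_i, β, (1−λ)·β) chosen by an arbitrary (deterministic) function of the graph G_i. Then with probability at least 1 − 4/n⁹, simultaneously for all vertices v ∈ V: |deg_{H₁}(v) − deg_{H₂}(v)| ≤ C·(log n)·λ^{1/2}·β. -/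

import Mathlib

/-- The degree of vertex `v` in the (sub)graph `H`. -/
noncomputable def deg {V : Type*} (H : SimpleGraph V) (v : V) : ℕ :=
  (H.neighborSet v).ncard

/-- `H` is an edge degree constrained subgraph `EDCS(G, β, β⁻)`. -/
def IsEDCS {V : Type*} (G H : SimpleGraph V) (β βm : ℝ) : Prop :=
  H ≤ G ∧
    (∀ u v : V, H.Adj u v → (deg H u : ℝ) + (deg H v : ℝ) ≤ β) ∧
    (∀ u v : V, G.Adj u v → ¬ H.Adj u v → βm ≤ (deg H u : ℝ) + (deg H v : ℝ))

/-- The probability weight of the outcome `ω` when each potential edge is kept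
independently with probability `p`. -/
noncomputable def pw {V : Type*} [Fintype V] [DecidableEq V] (p : ℝ)
    (ω : Sym2 V → Bool) : ℝ :=
  ∏ e : Sym2 V, (if ω e then p else 1 - p)

/-- The edge sampled subgraph of `G` determined by the outcome `ω`: it keeps exactly the
edges `e` of `G` with `ω e = true`. -/
def esub {V : Type*} (G : SimpleGraph V) (ω : Sym2 V → Bool) : SimpleGraph V :=
  G ⊓ SimpleGraph.fromEdgeSet {e | ω e = true}

/-- Probability of the event `A` under the edge-sampling distribution with probability `p`. -/
noncomputable def PrE {V : Type*} [Fintype V] [DecidableEq V] (p : ℝ)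
    (A : Set (Sym2 V → Bool)) : ℝ :=
  ∑ ω : Sym2 V → Bool, A.indicator (pw p) ω

open Finset in
/-- Bernoulli product measure: the moment generating function of the number of kept edges. -/
theorem sum_pw_mul_exp {V : Type*} [Fintype V] [DecidableEq V] (p s : ℝ) (F : Finset (Sym2 V)) :
    ∑ ω : Sym2 V → Bool, pw p ω * Real.exp (s * ∑ e ∈ F, (if ω e then 1 else 0)) =
      (1 + p * (Real.exp s - 1)) ^ #F := by
  have hterm : ∀ ω : Sym2 V → Bool,
      pw p ω * Real.exp (s * ∑ e ∈ F, (if ω e then 1 else 0)) =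
        ∏ e : Sym2 V, (if ω e then p else 1 - p) *
          (if e ∈ F then Real.exp (s * if ω e then 1 else 0) else 1) := by
    intro ω
    rw [prod_mul_distrib, prod_ite_mem, univ_inter, mul_sum, Real.exp_sum, pw]
  simp_rw [hterm]
  rw [← Fintype.prod_sum (fun (e : Sym2 V) (b : Bool) => (if b then p else 1 - p) *
          (if e ∈ F then Real.exp (s * if b then 1 else 0) else 1))]
  have hfac : ∀ e : Sym2 V, (∑ b : Bool, (if b then p else 1 - p) *
      (if e ∈ F then Real.exp (s * if b then 1 else 0) else 1)) =
        if e ∈ F then 1 + p * (Real.exp s - 1) else 1 := by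
    intro e
    by_cases he : e ∈ F <;> simp [he] ; ring
  simp_rw [hfac]
  rw [prod_ite_mem, univ_inter, prod_const]

theorem pw_nonneg {V : Type*} [Fintype V] [DecidableEq V] {p : ℝ} (hp : 0 ≤ p) (hp1 : p ≤ 1)
    (ω : Sym2 V → Bool) : 0 ≤ pw p ω :=
  Finset.prod_nonneg fun e _ => by split_ifs <;> linarith

theorem PrE_mono {V : Type*} [Fintype V] [DecidableEq V] {p : ℝ} (hp : 0 ≤ p) (hp1 : p ≤ 1)
    {A B : Set (Sym2 V → Bool)} (h : A ⊆ B) : PrE p A ≤ PrE p B :=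
  Finset.sum_le_sum fun ω _ =>
    Set.indicator_le_indicator_of_subset h (fun ω => pw_nonneg hp hp1 ω) ω

theorem PrE_iUnion_le {V ι : Type*} [Fintype V] [DecidableEq V] [Fintype ι] {p : ℝ} (hp : 0 ≤ p)
    (hp1 : p ≤ 1) (A : ι → Set (Sym2 V → Bool)) : PrE p (⋃ i, A i) ≤ ∑ i, PrE p (A i) := by
  unfold PrE
  rw [Finset.sum_comm]
  refine Finset.sum_le_sum fun ω _ => ?_
  have hnn : ∀ i ∈ Finset.univ, 0 ≤ (A i).indicator (pw p) ω := fun i _ =>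
    Set.indicator_nonneg (fun ω _ => pw_nonneg hp hp1 ω) ω
  by_cases hω : ω ∈ ⋃ i, A i
  · obtain ⟨i, hi⟩ := Set.mem_iUnion.1 hω
    rw [Set.indicator_of_mem hω, ← Set.indicator_of_mem hi (pw p)]
    exact Finset.single_le_sum hnn (Finset.mem_univ i)
  · rw [Set.indicator_of_notMem hω]
    exact Finset.sum_nonneg hnn

open Finset in
/-- Exponential Markov inequality for the number of kept edges in `F`. -/
theorem PrE_chernoff {V : Type*} [Fintype V] [DecidableEq V] {p : ℝ} (hp : 0 ≤ p) (hp1 : p ≤ 1)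
    (F : Finset (Sym2 V)) {s : ℝ} (hs : |s| ≤ 1) (a : ℝ) :
    PrE p {ω | a ≤ s * ((∑ e ∈ F, if ω e then 1 else 0) - p * #F)} ≤
      Real.exp (p * #F * s ^ 2 - a) := by
  have hbound : ∀ ω : Sym2 V → Bool,
      Set.indicator {ω : Sym2 V → Bool | a ≤ s * ((∑ e ∈ F, if ω e then 1 else 0) - p * #F)}
        (pw p) ω ≤ Real.exp (-a - s * p * #F) *
          (pw p ω * Real.exp (s * ∑ e ∈ F, (if ω e then 1 else 0))) := by
    intro ω
    refine Set.indicator_le' (f := pw p) (g := fun ω => Real.exp (-a - s * p * #F) *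
          (pw p ω * Real.exp (s * ∑ e ∈ F, (if ω e then 1 else 0)))) ?_ ?_ ω
    · intro ω hω
      have h0 := pw_nonneg hp hp1 ω
      rw [mul_left_comm, ← Real.exp_add]
      refine le_mul_of_one_le_right h0 (Real.one_le_exp ?_)
      simp only [Set.mem_ofPred_eq] at hω
      linarith
    · intro ω _
      have h0 := pw_nonneg hp hp1 ω
      positivity
  refine (sum_le_sum fun ω _ => hbound ω).trans ?_
  rw [← mul_sum, sum_pw_mul_exp]
  have h1 : 0 ≤ 1 + p * (Real.exp s - 1) := by nlinarith [Real.exp_pos s]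
  have h2 : (1 + p * (Real.exp s - 1)) ^ #F ≤ Real.exp (#F * (p * (Real.exp s - 1))) := by
    rw [Real.exp_nat_mul]
    gcongr
    linarith [Real.add_one_le_exp (p * (Real.exp s - 1))]
  refine (mul_le_mul_of_nonneg_left h2 (Real.exp_pos _).le).trans ?_
  rw [← Real.exp_add, Real.exp_le_exp]
  have h3 := (abs_le.1 (Real.abs_exp_sub_one_sub_id_le hs)).2
  have h4 : 0 ≤ p * #F := by positivity
  nlinarith [mul_le_mul_of_nonneg_left h3 h4]

open Classical in
theorem deg_eq_card {V : Type*} [Fintype V] (H : SimpleGraph V) (v : V) :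
    deg H v = (Finset.univ.filter (H.Adj v)).card := by
  rw [deg, Set.ncard_eq_toFinset_card']
  congr 1
  ext w
  simp

open Classical in
theorem deg_sup_edge {V : Type*} [Fintype V] (H : SimpleGraph V) {u v : V} (huv : u ≠ v)
    (hH : ¬ H.Adj u v) (w : V) :
    deg (H ⊔ SimpleGraph.edge u v) w = deg H w + (if w = u then 1 else 0)
      + (if w = v then 1 else 0) := by
  have hH' : ¬ H.Adj v u := fun h => hH h.symm
  simp only [deg_eq_card, SimpleGraph.sup_adj, SimpleGraph.edge_adj]
  by_cases hu : w = u
  · subst hu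
    have : (Finset.univ.filter fun x => H.Adj w x ∨ (w = w ∧ x = v ∨ w = v ∧ x = w) ∧ w ≠ x) =
        insert v (Finset.univ.filter (H.Adj w)) := by
      ext x; simp; grind
    rw [this, Finset.card_insert_of_notMem (by simpa using hH)]
    simp [huv]
  · by_cases hv : w = v
    · subst hv
      have : (Finset.univ.filter fun x => H.Adj w x ∨ (w = u ∧ x = w ∨ w = w ∧ x = u) ∧ w ≠ x) =
          insert u (Finset.univ.filter (H.Adj w)) := by
        ext x; simp; grind
      rw [this, Finset.card_insert_of_notMem (by simpa using hH')]
      simp [hu]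
    · simp [hu, hv]

theorem sum_potential_sup_edge {V : Type*} [Fintype V] (b : ℝ) (H : SimpleGraph V) {u v : V}
    (huv : u ≠ v) (hH : ¬ H.Adj u v) :
    ∑ w, (b * deg (H ⊔ SimpleGraph.edge u v) w - (deg (H ⊔ SimpleGraph.edge u v) w : ℝ) ^ 2) =
      ∑ w, (b * deg H w - (deg H w : ℝ) ^ 2) + 2 * (b - 1 - (deg H u + deg H v)) := by
  classical
  have hterm : ∀ w, b * deg (H ⊔ SimpleGraph.edge u v) w
      - (deg (H ⊔ SimpleGraph.edge u v) w : ℝ) ^ 2 = (b * deg H w - (deg H w : ℝ) ^ 2) +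
        ((if w = u then b - 1 - 2 * (deg H w : ℝ) else 0) +
          (if w = v then b - 1 - 2 * (deg H w : ℝ) else 0)) := by
    intro w
    rw [deg_sup_edge H huv hH]
    by_cases hu : w = u
    · simp [hu, huv]; ring
    · by_cases hv : w = v
      · simp [hv, huv.symm]; ring
      · simp [hu, hv]
  simp_rw [hterm, Finset.sum_add_distrib, Finset.sum_ite_eq', Finset.mem_univ, if_true]
  ring

/-- Every finite graph has an `EDCS(G, B, B - 2)`. -/
theorem exists_isEDCS {V : Type*} [Fintype V] (G : SimpleGraph V) (B : ℝ) :
    ∃ H, IsEDCS G H B (B - 2) := by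
  classical
  have : Nonempty {H : SimpleGraph V // H ≤ G} := ⟨⟨⊥, bot_le⟩⟩
  obtain ⟨⟨H, hHG⟩, hmax⟩ := Finite.exists_max fun H : {H : SimpleGraph V // H ≤ G} =>
    ∑ w, ((B - 1) * deg H.1 w - (deg H.1 w : ℝ) ^ 2)
  refine ⟨H, hHG, fun u v huv => ?_, fun u v huv hH => ?_⟩
  · set K := H.deleteEdges {s(u, v)} with hK
    have hKH : K ⊔ SimpleGraph.edge u v = H := by
      ext x y
      simp only [hK, SimpleGraph.sup_adj, SimpleGraph.deleteEdges_adj, SimpleGraph.edge_adj,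
        Set.mem_singleton_iff, Sym2.eq_iff]
      have := huv.symm
      have : ∀ {x y}, H.Adj x y → x ≠ y := fun h => h.ne
      grind
    have hKuv : ¬ K.Adj u v := by simp [hK]
    have h1 := sum_potential_sup_edge (B - 1) K huv.ne hKuv
    have h2 := hmax ⟨K, (SimpleGraph.deleteEdges_le _).trans hHG⟩
    have hu := deg_sup_edge K huv.ne hKuv u
    have hv := deg_sup_edge K huv.ne hKuv v
    rw [hKH] at h1 hu hv
    simp only [huv.ne, huv.ne.symm, if_true, if_false, add_zero] at hu hv
    rw [hu, hv]
    push_cast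
    dsimp only at h2
    linarith
  · have h1 := sum_potential_sup_edge (B - 1) H huv.ne hH
    have h2 := hmax ⟨H ⊔ SimpleGraph.edge u v,
      sup_le hHG ((SimpleGraph.edge_le_iff G).2 (Or.inr huv))⟩
    dsimp only at h2
    linarith

theorem IsEDCS.mono {V : Type*} {G H : SimpleGraph V} {b b' c c' : ℝ} (h : IsEDCS G H b c)
    (hb : b ≤ b') (hc : c' ≤ c) : IsEDCS G H b' c' :=
  ⟨h.1, fun u v huv => (h.2.1 u v huv).trans hb, fun u v huv hH => hc.trans (h.2.2 u v huv hH)⟩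

theorem IsEDCS.deg_le {V : Type*} [Fintype V] {G H : SimpleGraph V} {b c : ℝ}
    (h : IsEDCS G H b c) (hb : 0 ≤ b) (v : V) : (deg H v : ℝ) ≤ b := by
  classical
  by_cases h0 : deg H v = 0
  · simpa [h0] using hb
  · rw [deg_eq_card, Finset.card_eq_zero] at h0
    obtain ⟨u, hu⟩ := Finset.nonempty_iff_ne_empty.2 h0
    have := h.2.1 v u (by simpa using hu)
    have : (0 : ℝ) ≤ deg H u := by positivity
    linarith

theorem deg_sdiff_add_deg {V : Type*} [Fintype V] (A B : SimpleGraph V) (v : V) :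
    deg (A \ B) v + deg B v = deg (B \ A) v + deg A v := by
  classical
  have h : ∀ A B : SimpleGraph V, deg (A \ B) v + deg B v = deg (A ⊔ B) v := by
    intro A B
    simp only [deg_eq_card, SimpleGraph.sdiff_adj, SimpleGraph.sup_adj]
    rw [← Finset.card_union_of_disjoint]
    · congr 1
      ext x
      simp; tauto
    · rw [Finset.disjoint_filter]
      tauto
  rw [h, h, sup_comm]

/-- The neighbourhood of `S` receives every edge leaving `S`. -/
theorem sum_deg_le_sum_deg_neighbors {V : Type*} [Fintype V] (K : SimpleGraph V)
    (S T : Finset V) (hT : ∀ s ∈ S, ∀ t, K.Adj s t → t ∈ T) :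
    ∑ s ∈ S, deg K s ≤ ∑ t ∈ T, deg K t := by
  classical
  have h1 : ∀ s ∈ S, deg K s = (T.bipartiteAbove K.Adj s).card := by
    intro s hs
    rw [deg_eq_card]
    congr 1
    ext t
    simp only [Finset.mem_filter, Finset.mem_univ, true_and, Finset.bipartiteAbove]
    exact ⟨fun h => ⟨hT s hs t h, h⟩, fun h => h.2⟩
  rw [Finset.sum_congr rfl h1, Finset.sum_card_bipartiteAbove_eq_sum_card_bipartiteBelow]
  refine Finset.sum_le_sum fun t _ => ?_
  rw [deg_eq_card]
  refine Finset.card_le_card fun s hs => ?_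
  simp only [Finset.bipartiteBelow, Finset.mem_filter] at hs
  simpa using hs.2.symm

/-- Alternating between `A \ B` and `B \ A`, the number of edges reached from a vertex whose
degrees in the two subgraphs are far apart grows geometrically. -/
theorem exists_alternating_growth {V : Type*} [Fintype V] {G : SimpleGraph V} {b c D q : ℝ}
    (hb : 0 ≤ b) (hD : 0 < D) (hq : 0 ≤ q) (hqb : q * b ≤ D / 2) (hcb : c ≤ b) (i : ℕ) :
    ∀ {A B : SimpleGraph V}, IsEDCS G A b c → IsEDCS G B b c → i * (b - c) ≤ D / 2 →
      (∃ v, D ≤ (deg A v : ℝ) - deg B v) →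
      ∃ (X Y : SimpleGraph V) (S : Finset V), IsEDCS G X b c ∧ IsEDCS G Y b c ∧
        (∀ s ∈ S, D - i * (b - c) ≤ (deg X s : ℝ) - deg Y s) ∧
        (1 + q) ^ i ≤ ∑ s ∈ S, (deg (X \ Y) s : ℝ) := by
  classical
  induction i with
  | zero =>
    rintro A B hA hB - ⟨v, hv⟩
    refine ⟨A, B, {v}, hA, hB, by simpa using hv, ?_⟩
    have h1 := deg_sdiff_add_deg A B v
    have h2 : (deg B v : ℝ) < deg A v := by linarith
    have h3 : deg B v < deg A v := by exact_mod_cast h2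
    have h4 : 1 ≤ deg (A \ B) v := by omega
    simpa using h4
  | succ i ih =>
    intro A B hA hB hi hv
    push_cast at hi
    obtain ⟨X, Y, S, hX, hY, hS, hgrow⟩ := ih hA hB (by nlinarith) hv
    set T := Finset.univ.filter fun t => ∃ s ∈ S, (X \ Y).Adj s t with hTdef
    have hT : ∀ t ∈ T, D - (i + 1) * (b - c) ≤ (deg Y t : ℝ) - deg X t := by
      intro t ht
      obtain ⟨s, hs, hst⟩ := (Finset.mem_filter.1 ht).2
      rw [SimpleGraph.sdiff_adj] at hst
      have h1 := hX.2.1 s t hst.1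
      have h2 := hY.2.2 s t (hX.1 hst.1) hst.2
      have h3 := hS s hs
      linarith
    refine ⟨Y, X, T, hY, hX, by push_cast; exact hT, ?_⟩
    have hedges : ∑ s ∈ S, (deg (X \ Y) s : ℝ) ≤ ∑ t ∈ T, (deg (X \ Y) t : ℝ) := by
      exact_mod_cast sum_deg_le_sum_deg_neighbors (X \ Y) S T fun s hs t hst =>
        Finset.mem_filter.2 ⟨Finset.mem_univ t, s, hs, hst⟩
    have hgain : ∀ t ∈ T, (deg (X \ Y) t : ℝ) + q * deg (Y \ X) t ≤ deg (Y \ X) t := by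
      intro t ht
      have h1 : (deg (X \ Y) t : ℝ) + deg Y t = deg (Y \ X) t + deg X t := by
        exact_mod_cast deg_sdiff_add_deg X Y t
      have h2 := hT t ht
      have h3 : (deg (Y \ X) t : ℝ) ≤ b := by
        refine le_trans ?_ (hY.deg_le hb t)
        rw [deg_eq_card, deg_eq_card]
        exact_mod_cast Finset.card_le_card fun x hx => by
          simp only [Finset.mem_filter, SimpleGraph.sdiff_adj] at hx ⊢
          exact ⟨hx.1, hx.2.1⟩
      have h4 := mul_le_mul_of_nonneg_left h3 hq
      linarith
    have hsum := Finset.sum_le_sum hgain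
    rw [Finset.sum_add_distrib, ← Finset.mul_sum] at hsum
    have hpos : 0 ≤ ∑ t ∈ T, (deg (Y \ X) t : ℝ) := Finset.sum_nonneg fun t _ => by positivity
    have hle : (1 + q) ^ i ≤ ∑ t ∈ T, (deg (Y \ X) t : ℝ) := by
      nlinarith [mul_nonneg hq hpos]
    rw [pow_succ]
    nlinarith [mul_le_mul_of_nonneg_left hle hq]

/-- The degrees of a vertex in two EDCS of the same graph are close. -/
theorem IsEDCS.deg_sub_deg_lt {V : Type*} [Fintype V] {G A B : SimpleGraph V} {b c D q : ℝ}
    (hA : IsEDCS G A b c) (hB : IsEDCS G B b c) (hb : 0 ≤ b) (hcb : c ≤ b) (hD : 0 < D)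
    (hq : 0 ≤ q) (hq1 : q ≤ 1) (hqb : q * b ≤ D / 2) {i : ℕ} (hi : i * (b - c) ≤ D / 2)
    (hlog : 4 * Real.log (Fintype.card V) < i * q) (v : V) :
    (deg A v : ℝ) - deg B v < D := by
  classical
  by_contra! hv
  obtain ⟨X, Y, S, -, -, -, hgrow⟩ :=
    exists_alternating_growth hb hD hq hqb hcb i hA hB hi ⟨v, hv⟩
  have hn : 0 < (Fintype.card V : ℝ) := by exact_mod_cast Fintype.card_pos_iff.2 ⟨v⟩
  have hupper : ∑ s ∈ S, (deg (X \ Y) s : ℝ) ≤ (Fintype.card V : ℝ) ^ 2 := by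
    calc ∑ s ∈ S, (deg (X \ Y) s : ℝ) ≤ ∑ _s ∈ S, (Fintype.card V : ℝ) := by
          refine Finset.sum_le_sum fun s _ => ?_
          rw [deg_eq_card]
          exact_mod_cast Finset.card_le_univ _
      _ = (S.card : ℝ) * Fintype.card V := by simp
      _ ≤ (Fintype.card V : ℝ) * Fintype.card V := by
          gcongr
          exact Finset.card_le_univ _
      _ = _ := by ring
  have hexp : Real.exp (q / 2) ≤ 1 + q := by
    have h1 := (abs_le.1 (Real.abs_exp_sub_one_sub_id_le (x := q / 2)
      (by rw [abs_of_nonneg (by linarith)]; linarith))).2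
    nlinarith
  have h1 : Real.exp (i * (q / 2)) ≤ (Fintype.card V : ℝ) ^ 2 := by
    rw [Real.exp_nat_mul]
    exact (pow_le_pow_left₀ (Real.exp_pos _).le hexp i).trans (hgrow.trans hupper)
  have h2 := Real.log_le_log (Real.exp_pos _) h1
  rw [Real.log_exp, Real.log_pow] at h2
  push_cast at h2
  linarith

open Classical in
theorem deg_inf_esub {V : Type*} [Fintype V] [DecidableEq V] {G H : SimpleGraph V}
    (hHG : H ≤ G) (ω : Sym2 V → Bool) (v : V) :
    (deg (H ⊓ esub G ω) v : ℝ) =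
      ∑ e ∈ (Finset.univ.filter (H.Adj v)).image (fun u => s(v, u)), if ω e then 1 else 0 := by
  rw [Finset.sum_image fun x _ y _ h => Sym2.congr_right.1 h, Finset.sum_boole,
    Finset.filter_filter, deg_eq_card]
  congr 2
  ext u
  simp only [Finset.mem_filter, Finset.mem_univ, true_and]
  simp only [esub, SimpleGraph.inf_adj, SimpleGraph.fromEdgeSet_adj, Set.mem_ofPred_eq]
  exact ⟨fun h => ⟨h.1, h.2.2.1⟩, fun h => ⟨h.1, hHG h.1, h.2, h.1.ne⟩⟩

open Classical in
theorem PrE_deg_deviation_le {V : Type*} [Fintype V] [DecidableEq V] {G H : SimpleGraph V}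
    (hHG : H ≤ G) {p lam β : ℝ} (hp : 0 ≤ p) (hp1 : p ≤ 1) (hlam : 0 < lam) (hlam1 : lam ≤ 1)
    (v : V) (hdeg : p * deg H v ≤ β) :
    PrE p {ω | lam * β < |(deg (H ⊓ esub G ω) v : ℝ) - p * deg H v|} ≤
      2 * Real.exp (-(lam ^ 2 * β / 4)) := by
  set F := (Finset.univ.filter (H.Adj v)).image (fun u => s(v, u)) with hF
  have hcard : F.card = deg H v := by
    rw [hF, Finset.card_image_of_injective _ fun x y h => Sym2.congr_right.1 h, deg_eq_card]
  have htail : ∀ s : ℝ, s ^ 2 = lam ^ 2 / 4 → |s| ≤ 1 →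
      PrE p {ω | lam ^ 2 * β / 2 ≤ s * ((∑ e ∈ F, if ω e then 1 else 0) - p * F.card)} ≤
        Real.exp (-(lam ^ 2 * β / 4)) := by
    intro s hs hs1
    convert (PrE_chernoff hp hp1 F hs1 (lam ^ 2 * β / 2)).trans (Real.exp_le_exp.2 ?_)
    rw [hs, hcard]
    nlinarith [sq_nonneg lam]
  have hpos := htail (lam / 2) (by ring) (by rw [abs_of_pos] <;> linarith)
  have hneg := htail (-(lam / 2)) (by ring) (by rw [abs_neg, abs_of_pos] <;> linarith)
  have hunion := (PrE_mono hp hp1 (A := {ω | lam * β <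
      |(deg (H ⊓ esub G ω) v : ℝ) - p * deg H v|}) (B := ⋃ b : Bool, {ω | lam ^ 2 * β / 2 ≤
        (if b then lam / 2 else -(lam / 2)) *
          ((∑ e ∈ F, if ω e then 1 else 0) - p * F.card)}) ?_).trans
    (PrE_iUnion_le hp hp1 _)
  · rw [Fintype.sum_bool] at hunion
    simp only [if_true, Bool.false_eq_true, if_false] at hunion
    linarith
  · intro ω hω
    rw [Set.mem_ofPred_eq, deg_inf_esub hHG, ← hF, ← hcard, lt_abs] at hω
    rw [Set.mem_iUnion]
    rcases hω with h | h
    · refine ⟨true, ?_⟩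
      simp only [if_true, Set.mem_ofPred_eq]
      nlinarith
    · refine ⟨false, ?_⟩
      simp only [Bool.false_eq_true, if_false, Set.mem_ofPred_eq]
      nlinarith

open Classical in
theorem sum_indicator_preimage_eq_sum_fibers {α β : Type*} [Fintype α] [Fintype β] (f : α → β)
    (P : Set β) (u : α → ℝ) :
    ∑ a, Set.indicator (f ⁻¹' P) u a =
      ∑ b ∈ Finset.univ.filter (· ∈ P), ∑ a, Set.indicator {a' | f a' = b} u a := by
  rw [Finset.sum_comm]
  refine Finset.sum_congr rfl fun a _ => ?_
  simp only [Set.indicator_apply, Set.mem_preimage, Set.mem_ofPred_eq, Finset.sum_ite_eq,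
    Finset.mem_filter, Finset.mem_univ, true_and]

/-- Transfer of a probability bound from the sampling space to a random graph with the same
marginal distribution. -/
theorem sum_indicator_preimage_eq_PrE {V Ω : Type*} [Fintype V] [DecidableEq V] [Fintype Ω]
    {G : SimpleGraph V} {p : ℝ} {w : Ω → ℝ} {T : Ω → SimpleGraph V}
    (hT : ∀ X : SimpleGraph V, (∑ o : Ω, Set.indicator {o' : Ω | T o' = X} w o) =
      PrE p {ω : Sym2 V → Bool | esub G ω = X}) (P : Set (SimpleGraph V)) :
    ∑ o, Set.indicator (T ⁻¹' P) w o = PrE p (esub G ⁻¹' P) := by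
  rw [sum_indicator_preimage_eq_sum_fibers T P w, PrE,
    sum_indicator_preimage_eq_sum_fibers (esub G) P (pw p)]
  exact Finset.sum_congr rfl fun X _ => hT X

/-- `EDCS` degrees of a sampled subgraph are concentrated around the scaled degrees of any
subgraph `K` of `G` whose sampled version has concentrated degrees. -/
theorem IsEDCS.abs_deg_sub_scaled_le {V : Type*} [Fintype V] {G K H : SimpleGraph V}
    {p lam β : ℝ} (hn : 2 ≤ Fintype.card V) (hp : 0 < p) (hp1 : p ≤ 1) (hlam : 0 < lam)
    (hlam1 : lam < 1 / 100) (hβ : 750 / lam ^ 2 * Real.log (Fintype.card V) ≤ β)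
    (hK : IsEDCS G K (β / p) (β / p - 2)) {T : SimpleGraph V} (hT : T ≤ G)
    (hconc : ∀ v, |(deg (K ⊓ T) v : ℝ) - p * deg K v| ≤ lam * β)
    (hH : IsEDCS T H β ((1 - lam) * β)) (v : V) :
    |(deg H v : ℝ) - p * deg K v| ≤ 101 * Real.log (Fintype.card V) * √lam * β := by
  set L := Real.log (Fintype.card V) with hL
  have hL2 : 0.69 ≤ L := by
    have := Real.log_le_log (by norm_num) (show (2 : ℝ) ≤ Fintype.card V by exact_mod_cast hn)
    linarith [Real.log_two_gt_d9]
  set r := √lam with hr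
  have hr0 : 0 < r := Real.sqrt_pos.2 hlam
  have hrr : r * r = lam := Real.mul_self_sqrt hlam.le
  have hr1 : r < 1 / 10 := by nlinarith
  have hβL : 750 * L ≤ lam ^ 2 * β := by
    rw [div_mul_eq_mul_div, div_le_iff₀ (by positivity)] at hβ
    linarith
  have hβ0 : 0 < β := by
    by_contra! h
    nlinarith [sq_nonneg lam]
  have hlamβ : 2 ≤ lam * β := by nlinarith [mul_pos hlam hβ0]
  have hKT : IsEDCS T (K ⊓ T) ((1 + 2 * lam) * β) ((1 - 3 * lam) * β) := by
    refine ⟨inf_le_right, fun a b hab => ?_, fun a b hab hKab => ?_⟩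
    · have h1 := hK.2.1 a b hab.1
      rw [le_div_iff₀ hp] at h1
      linarith [(abs_le.1 (hconc a)).2, (abs_le.1 (hconc b)).2]
    · have h1 := hK.2.2 a b (hT hab) fun h => hKab ⟨h, hab⟩
      rw [sub_le_iff_le_add, div_le_iff₀ hp] at h1
      linarith [(abs_le.1 (hconc a)).1, (abs_le.1 (hconc b)).1]
  have hH' : IsEDCS T H ((1 + 2 * lam) * β) ((1 - 3 * lam) * β) :=
    hH.mono (by nlinarith) (by nlinarith)
  set i := ⌊10 * L / r⌋₊ with hi
  have hile : i * r ≤ 10 * L := (le_div_iff₀ hr0).1 (Nat.floor_le (by positivity))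
  have hige : 10 * L ≤ (i + 1) * r := (div_le_iff₀ hr0).1 (Nat.lt_floor_add_one _).le
  have hclose : ∀ {A B : SimpleGraph V}, IsEDCS T A ((1 + 2 * lam) * β) ((1 - 3 * lam) * β) →
      IsEDCS T B ((1 + 2 * lam) * β) ((1 - 3 * lam) * β) →
      (deg A v : ℝ) - deg B v < 100 * L * r * β := by
    intro A B hA hB
    refine hA.deg_sub_deg_lt (q := r) (i := i) hB (by positivity) (by nlinarith) (by positivity)
      hr0.le (by linarith) ?_ ?_ (by rw [← hL]; linarith) v
    · have : 0 < r * β := by positivity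
      nlinarith
    · have : 0 < r * β := by positivity
      have : i * ((1 + 2 * lam) * β - (1 - 3 * lam) * β) = 5 * (i * r) * (r * β) := by
        rw [← hrr]; ring
      rw [this]
      nlinarith
  have h1 := hclose hH' hKT
  have h2 := hclose hKT hH'
  have h3 := abs_le.1 (hconc v)
  have h4 : lam * β ≤ L * r * β := by
    rw [← hrr]
    have : r ≤ L := by linarith
    gcongr
  rw [abs_le]
  constructor <;> linarith

/-- With high probability every vertex keeps about a `p` fraction of its `K`-edges. -/
theorem sum_indicator_not_concentrated_le {V Ω : Type*} [Fintype V] [DecidableEq V] [Fintype Ω]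
    {G K : SimpleGraph V} (hKG : K ≤ G) {p lam β : ℝ} (hn : 2 ≤ Fintype.card V) (hp : 0 ≤ p)
    (hp1 : p ≤ 1) (hlam : 0 < lam) (hlam1 : lam ≤ 1)
    (hβ : 750 / lam ^ 2 * Real.log (Fintype.card V) ≤ β) (hdeg : ∀ v, p * deg K v ≤ β)
    {w : Ω → ℝ} {T : Ω → SimpleGraph V}
    (hT : ∀ X : SimpleGraph V, (∑ o : Ω, Set.indicator {o' : Ω | T o' = X} w o) =
      PrE p {ω : Sym2 V → Bool | esub G ω = X}) :
    ∑ o, Set.indicator (T ⁻¹' {X | ∀ v, |(deg (K ⊓ X) v : ℝ) - p * deg K v| ≤ lam * β}ᶜ) w o ≤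
      2 / (Fintype.card V : ℝ) ^ 9 := by
  have hn0 : 0 < (Fintype.card V : ℝ) := by positivity
  have hL : 0 ≤ Real.log (Fintype.card V) := Real.log_nonneg (by exact_mod_cast (by omega))
  have hexp : Real.exp (-(lam ^ 2 * β / 4)) ≤ ((Fintype.card V : ℝ) ^ 10)⁻¹ := by
    rw [← Real.exp_log (pow_pos hn0 10), ← Real.exp_neg, Real.exp_le_exp, Real.log_pow]
    rw [div_mul_eq_mul_div, div_le_iff₀ (by positivity)] at hβ
    push_cast
    linarith
  rw [sum_indicator_preimage_eq_PrE hT]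
  calc PrE p (esub G ⁻¹' {X | ∀ v, |(deg (K ⊓ X) v : ℝ) - p * deg K v| ≤ lam * β}ᶜ)
      ≤ PrE p (⋃ v, {ω | lam * β < |(deg (K ⊓ esub G ω) v : ℝ) - p * deg K v|}) :=
        PrE_mono hp hp1 fun ω hω => by simpa using hω
    _ ≤ ∑ v, PrE p {ω | lam * β < |(deg (K ⊓ esub G ω) v : ℝ) - p * deg K v|} :=
        PrE_iUnion_le hp hp1 _
    _ ≤ ∑ _v : V, 2 * ((Fintype.card V : ℝ) ^ 10)⁻¹ :=
        Finset.sum_le_sum fun v _ =>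
          (PrE_deg_deviation_le hKG hp hp1 hlam hlam1 v (hdeg v)).trans (by linarith)
    _ = 2 / (Fintype.card V : ℝ) ^ 9 := by
        rw [Finset.sum_const, Finset.card_univ, nsmul_eq_mul]
        field_simp

/-- A positive-weight outcome outside two bad events lies in the good event. -/
theorem one_sub_le_sum_indicator {Ω : Type*} [Fintype Ω] {w : Ω → ℝ} (hw : ∀ o, 0 ≤ w o)
    (hw1 : ∑ o, w o = 1) {A B E : Set Ω} (h : ∀ o, 0 < w o → o ∉ A → o ∉ B → o ∈ E) :
    1 - (∑ o, A.indicator w o + ∑ o, B.indicator w o) ≤ ∑ o, E.indicator w o := by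
  classical
  rw [← hw1, ← Finset.sum_add_distrib, ← Finset.sum_sub_distrib]
  refine Finset.sum_le_sum fun o _ => ?_
  have h0 := hw o
  simp only [Set.indicator_apply]
  rcases h0.eq_or_lt with h0 | h0
  · simp [← h0]
  · have := h o h0
    split_ifs <;> first | linarith | tauto

/-- A random graph distributed as an edge sampled subgraph of `G` is a subgraph of `G`. -/
theorem le_of_marginal {V Ω : Type*} [Fintype V] [DecidableEq V] [Fintype Ω]
    {G : SimpleGraph V} {p : ℝ} {w : Ω → ℝ} (hw : ∀ o, 0 ≤ w o) {T : Ω → SimpleGraph V}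
    (hT : ∀ X : SimpleGraph V, (∑ o : Ω, Set.indicator {o' : Ω | T o' = X} w o) =
      PrE p {ω : Sym2 V → Bool | esub G ω = X}) {o : Ω} (ho : 0 < w o) : T o ≤ G := by
  by_contra hle
  have hempty : {ω : Sym2 V → Bool | esub G ω = T o} = ∅ := by
    refine Set.eq_empty_of_forall_notMem fun ω hω => hle ?_
    rw [← Set.mem_ofPred_eq.mp hω]
    exact inf_le_left
  have hzero := hT (T o)
  simp only [hempty, PrE, Set.indicator_empty, Finset.sum_const_zero] at hzero
  have hpos : w o ≤ ∑ o'', Set.indicator {o' : Ω | T o' = T o} w o'' := by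
    refine le_trans ?_ (Finset.single_le_sum (fun a _ => Set.indicator_nonneg (fun a _ => hw a) a)
      (Finset.mem_univ o))
    simp
  linarith

/-- EDCS in edge sampled subgraphs: there is an absolute constant `C > 0` such that the
following holds.  Fix a graph `G` on `n ≥ 2` vertices, `p ∈ (0,1]`, `λ ∈ (0,1/100)` and
`β ≥ 750·λ⁻²·log n`.  Let `T₁, T₂` be two random subgraphs of `G` on a common (finite)
probability space `(Ω, w)`, each marginally distributed as the edge sampled subgraph of
`G` with probability `p` (not necessarily independent), and for `i ∈ {1,2}` let
`H_i = f_i(T_i)` be an `EDCS(T_i, β, (1-λ)β)` chosen by an arbitrary deterministic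
function `f_i` of the graph `T_i`.  Then with probability at least `1 - 4/n⁹`,
simultaneously for all vertices `v`, `|deg_{H₁}(v) - deg_{H₂}(v)| ≤ C·(log n)·√λ·β`. -/
theorem edcs_degrees_edge_sampled :
    ∃ C : ℝ, 0 < C ∧
      ∀ (V : Type) [Fintype V] [DecidableEq V] (G : SimpleGraph V) (p lam β : ℝ),
        2 ≤ Fintype.card V → 0 < p → p ≤ 1 → 0 < lam → lam < 1 / 100 →
        750 / lam ^ 2 * Real.log (Fintype.card V) ≤ β →
        ∀ (Ω : Type) [Fintype Ω] (w : Ω → ℝ),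
          (∀ o : Ω, 0 ≤ w o) → (∑ o : Ω, w o) = 1 →
          ∀ T₁ T₂ : Ω → SimpleGraph V,
            (∀ X : SimpleGraph V,
              (∑ o : Ω, Set.indicator {o' : Ω | T₁ o' = X} w o) =
                PrE p {ω : Sym2 V → Bool | esub G ω = X}) →
            (∀ X : SimpleGraph V,
              (∑ o : Ω, Set.indicator {o' : Ω | T₂ o' = X} w o) =
                PrE p {ω : Sym2 V → Bool | esub G ω = X}) →
            ∀ f₁ f₂ : SimpleGraph V → SimpleGraph V,
              (∀ o : Ω, 0 < w o → IsEDCS (T₁ o) (f₁ (T₁ o)) β ((1 - lam) * β)) →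
              (∀ o : Ω, 0 < w o → IsEDCS (T₂ o) (f₂ (T₂ o)) β ((1 - lam) * β)) →
              1 - 4 / (Fintype.card V : ℝ) ^ 9 ≤
                ∑ o : Ω, Set.indicator
                  {o' : Ω | ∀ v : V,
                    |(deg (f₁ (T₁ o')) v : ℝ) - (deg (f₂ (T₂ o')) v : ℝ)| ≤
                      C * Real.log (Fintype.card V) * Real.sqrt lam * β} w o := by
  refine ⟨202, by norm_num, ?_⟩
  intro V _ _ G p lam β hn hp hp1 hlam hlam1 hβ Ω _ w hw hw1 T₁ T₂ hT₁ hT₂ f₁ f₂ hf₁ hf₂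
  obtain ⟨K, hK⟩ := exists_isEDCS G (β / p)
  have hL : 0 ≤ Real.log (Fintype.card V) := Real.log_nonneg (by exact_mod_cast (by omega))
  have hβ0 : 0 ≤ β := le_trans (by positivity) hβ
  have hdeg : ∀ v, p * deg K v ≤ β := fun v => by
    have := hK.deg_le (by positivity) v
    rwa [le_div_iff₀ hp, mul_comm] at this
  have hbad₁ := sum_indicator_not_concentrated_le hK.1 hn hp.le hp1 hlam (by linarith) hβ hdeg hT₁
  have hbad₂ := sum_indicator_not_concentrated_le hK.1 hn hp.le hp1 hlam (by linarith) hβ hdeg hT₂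
  refine le_trans ?_ (one_sub_le_sum_indicator hw hw1 (A := T₁ ⁻¹' {X | ∀ v,
    |(deg (K ⊓ X) v : ℝ) - p * deg K v| ≤ lam * β}ᶜ) (B := T₂ ⁻¹' {X | ∀ v,
    |(deg (K ⊓ X) v : ℝ) - p * deg K v| ≤ lam * β}ᶜ) ?_)
  · have : 4 / (Fintype.card V : ℝ) ^ 9 = 2 / (Fintype.card V : ℝ) ^ 9 +
      2 / (Fintype.card V : ℝ) ^ 9 := by ring
    linarith
  · intro o ho h₁ h₂ v
    simp only [Set.mem_preimage, Set.mem_compl_iff, not_not, Set.mem_ofPred_eq] at h₁ h₂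
    have hd₁ := abs_le.1 (hK.abs_deg_sub_scaled_le hn hp hp1 hlam hlam1 hβ
      (le_of_marginal hw hT₁ ho) h₁ (hf₁ o ho) v)
    have hd₂ := abs_le.1 (hK.abs_deg_sub_scaled_le hn hp hp1 hlam hlam1 hβ
      (le_of_marginal hw hT₂ ho) h₂ (hf₂ o ho) v)
    rw [abs_le]
    constructor <;> linarith
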